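/- arXiv:1702.08809 — 3 statements merged into one kernel-verified Lean document; each statement's English description precedes it below -/
import Mathlib

section
/- Let α > 0, C_F > 0 and let F : ℝ² → ℝ be continuous with |F(y)| ≤ C_F(|y| + 1) for all y ∈ ℝ². Then there exists a constant C > 0, depending only on α and C_F, such that for every δ > 0 and every twice continuously differentiable function u : ℝ² → ℝ which has at most linear growth (i.e. |u(y)| ≤ K(1 + |y|) for some K > 0) and satisfies δ u(y) − (∂²u/∂y₁²(y) + y₁² ∂²u/∂y₂²(y)) + α y·∇u(y) = F(y) for all y ∈ ℝ², one has |u(y)| ≤ C(|y| + 1/δ) for all y ∈ ℝ². -/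
/-- Euclidean norm on `ℝ²`. -/
noncomputable def nrm (p : ℝ × ℝ) : ℝ := Real.sqrt (p.1 ^ 2 + p.2 ^ 2)

/-- First partial derivative `∂u/∂y₁`. -/
noncomputable def pd1 (u : ℝ × ℝ → ℝ) (p : ℝ × ℝ) : ℝ := deriv (fun t => u (t, p.2)) p.1

/-- First partial derivative `∂u/∂y₂`. -/
noncomputable def pd2 (u : ℝ × ℝ → ℝ) (p : ℝ × ℝ) : ℝ := deriv (fun t => u (p.1, t)) p.2

/-- Second partial derivative `∂²u/∂y₁²`. -/
noncomputable def pd11 (u : ℝ × ℝ → ℝ) (p : ℝ × ℝ) : ℝ := deriv (fun t => pd1 u (t, p.2)) p.1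

/-- Second partial derivative `∂²u/∂y₂²`. -/
noncomputable def pd22 (u : ℝ × ℝ → ℝ) (p : ℝ × ℝ) : ℝ := deriv (fun t => pd2 u (p.1, t)) p.2

/-- The Grushin–Ornstein–Uhlenbeck operator
`u ↦ −(∂²u/∂y₁² + y₁² ∂²u/∂y₂²) + α y·∇u` on `ℝ²`. -/
noncomputable def GOU (α : ℝ) (u : ℝ × ℝ → ℝ) (p : ℝ × ℝ) : ℝ :=
  -(pd11 u p + p.1 ^ 2 * pd22 u p) + α * (p.1 * pd1 u p + p.2 * pd2 u p)

open Filter Topology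

/-- Second-order necessary condition at a local minimum. -/
lemma IsLocalMin.deriv_deriv_nonneg {f : ℝ → ℝ} {x : ℝ} (h : IsLocalMin f x)
    (hc : ContinuousAt f x) : 0 ≤ deriv (deriv f) x := by
  by_contra! hneg
  have hmax := isLocalMax_of_deriv_deriv_neg hneg h.deriv_eq_zero hc
  have hconst : f =ᶠ[𝓝 x] fun _ => f x := by
    filter_upwards [h, hmax] with y h₁ h₂ using le_antisymm h₂ h₁
  have hzero : deriv (deriv f) x = 0 := by
    rw [hconst.deriv.deriv_eq]
    simp
  exact hneg.ne hzero

lemma ContDiff.section_fst {u : ℝ × ℝ → ℝ} (hu : ContDiff ℝ 2 u) (b : ℝ) :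
    ContDiff ℝ 2 fun t => u (t, b) :=
  hu.comp (contDiff_id.prodMk contDiff_const)

lemma ContDiff.section_snd {u : ℝ × ℝ → ℝ} (hu : ContDiff ℝ 2 u) (a : ℝ) :
    ContDiff ℝ 2 fun t => u (a, t) :=
  hu.comp (contDiff_const.prodMk contDiff_id)

lemma ContDiff.differentiable_deriv_of_two {f : ℝ → ℝ} (hf : ContDiff ℝ 2 f) :
    Differentiable ℝ (deriv f) :=
  ((contDiff_succ_iff_deriv (n := 1)).1 hf).2.2.differentiable one_ne_zero

lemma deriv_deriv_sub_of_contDiff {f g : ℝ → ℝ} (hf : ContDiff ℝ 2 f) (hg : ContDiff ℝ 2 g)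
    (x : ℝ) :
    deriv (deriv fun t => f t - g t) x = deriv (deriv f) x - deriv (deriv g) x := by
  have h : (deriv fun t => f t - g t) = fun t => deriv f t - deriv g t := by
    funext t
    exact deriv_fun_sub (hf.differentiable two_ne_zero t) (hg.differentiable two_ne_zero t)
  rw [h]
  exact deriv_fun_sub (hf.differentiable_deriv_of_two x) (hg.differentiable_deriv_of_two x)

/-- The operator in terms of one-dimensional derivatives along the coordinate lines. -/
lemma GOU_eq_deriv (α : ℝ) (u : ℝ × ℝ → ℝ) (x y : ℝ) :
    GOU α u (x, y) =
      -(deriv (deriv fun t => u (t, y)) x + x ^ 2 * deriv (deriv fun t => u (x, t)) y)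
        + α * (x * deriv (fun t => u (t, y)) x + y * deriv (fun t => u (x, t)) y) :=
  rfl

lemma GOU_sub (α : ℝ) {u v : ℝ × ℝ → ℝ} (hu : ContDiff ℝ 2 u) (hv : ContDiff ℝ 2 v)
    (p : ℝ × ℝ) : GOU α (fun q => u q - v q) p = GOU α u p - GOU α v p := by
  obtain ⟨x, y⟩ := p
  simp only [GOU_eq_deriv]
  rw [deriv_deriv_sub_of_contDiff (hu.section_fst y) (hv.section_fst y),
    deriv_deriv_sub_of_contDiff (hu.section_snd x) (hv.section_snd x),
    deriv_fun_sub ((hu.section_fst y).differentiable two_ne_zero x)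
      ((hv.section_fst y).differentiable two_ne_zero x),
    deriv_fun_sub ((hu.section_snd x).differentiable two_ne_zero y)
      ((hv.section_snd x).differentiable two_ne_zero y)]
  ring

lemma GOU_neg (α : ℝ) (u : ℝ × ℝ → ℝ) (p : ℝ × ℝ) :
    GOU α (fun q => -u q) p = -GOU α u p := by
  obtain ⟨x, y⟩ := p
  have h : ∀ f : ℝ → ℝ, (deriv fun t => -f t) = fun t => -deriv f t :=
    fun f => funext fun t => deriv.fun_neg
  simp only [GOU_eq_deriv, h]
  ring

/-- Maximum principle: a coercive supersolution is nonnegative. -/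
lemma nonneg_of_GOU_supersolution {α δ : ℝ} (hδ : 0 < δ) {v : ℝ × ℝ → ℝ} (hv : Continuous v)
    (hlim : Tendsto v (cocompact (ℝ × ℝ)) atTop) (hsup : ∀ p, 0 ≤ δ * v p + GOU α v p)
    (p : ℝ × ℝ) : 0 ≤ v p := by
  obtain ⟨⟨x, y⟩, hmin⟩ := hv.exists_forall_le hlim
  have h₁ : IsLocalMin (fun t => v (t, y)) x := Eventually.of_forall fun t => hmin (t, y)
  have h₂ : IsLocalMin (fun t => v (x, t)) y := Eventually.of_forall fun t => hmin (x, t)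
  have d₁ := h₁.deriv_deriv_nonneg (by fun_prop)
  have d₂ := h₂.deriv_deriv_nonneg (by fun_prop)
  have key := hsup (x, y)
  rw [GOU_eq_deriv, h₁.deriv_eq_zero, h₂.deriv_eq_zero] at key
  have hq : 0 ≤ δ * v (x, y) := by nlinarith [mul_nonneg (sq_nonneg x) d₂]
  exact (nonneg_of_mul_nonneg_right hq hδ).trans (hmin p)

lemma hasDerivAt_sqrt_add_mul_sq {c a : ℝ} (hc : 0 < c) (ha : 0 ≤ a) (t : ℝ) :
    HasDerivAt (fun t => √(c + a * t ^ 2)) (a * t / √(c + a * t ^ 2)) t := by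
  have hpos : 0 < c + a * t ^ 2 := by positivity
  have h : HasDerivAt (fun t => c + a * t ^ 2) (a * (2 * t)) t := by
    simpa using ((hasDerivAt_pow 2 t).const_mul a).const_add c
  convert h.sqrt hpos.ne' using 1
  field_simp

lemma deriv_barrier_section {c a : ℝ} (hc : 0 < c) (ha : 0 ≤ a) (k η e : ℝ) :
    (deriv fun t => k * √(c + a * t ^ 2) + η * (a * t ^ 2) + e) =
      fun t => k * (a * t / √(c + a * t ^ 2)) + η * (a * (2 * t)) := by
  funext t
  have h : HasDerivAt (fun t => η * (a * t ^ 2)) (η * (a * (2 * t))) t := by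
    simpa using ((hasDerivAt_pow 2 t).const_mul a).const_mul η
  exact ((((hasDerivAt_sqrt_add_mul_sq hc ha t).const_mul k).add h).add_const e).deriv

lemma deriv_deriv_barrier_section {c a : ℝ} (hc : 0 < c) (ha : 0 ≤ a) (k η e t : ℝ) :
    deriv (deriv fun t => k * √(c + a * t ^ 2) + η * (a * t ^ 2) + e) t =
      k * (a * c / √(c + a * t ^ 2) ^ 3) + η * (a * 2) := by
  rw [deriv_barrier_section hc ha]
  have hpos : 0 < c + a * t ^ 2 := by positivity
  have hs : 0 < √(c + a * t ^ 2) := Real.sqrt_pos.2 hpos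
  have hsq : √(c + a * t ^ 2) ^ 2 = c + a * t ^ 2 := Real.sq_sqrt hpos.le
  have h₁ : HasDerivAt (fun t => a * t) a t := by
    simpa using (hasDerivAt_id t).const_mul a
  have h₂ : HasDerivAt (fun t => η * (a * (2 * t))) (η * (a * 2)) t := by
    simpa using (((hasDerivAt_id t).const_mul 2).const_mul a).const_mul η
  have h := ((h₁.div (hasDerivAt_sqrt_add_mul_sq hc ha t) hs.ne').const_mul k).add h₂
  refine h.deriv.trans ?_
  congr 2
  field_simp
  rw [hsq]
  ring

/-- The barrier: an anisotropic norm plus a small quadratic and a constant. -/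
noncomputable def barrier (A k η e : ℝ) (p : ℝ × ℝ) : ℝ :=
  k * √(1 + A * p.1 ^ 2 + p.2 ^ 2) + η * (A * p.1 ^ 2 + p.2 ^ 2) + e

lemma contDiff_barrier {A : ℝ} (hA : 0 ≤ A) (k η e : ℝ) : ContDiff ℝ 2 (barrier A k η e) := by
  have h : ContDiff ℝ 2 fun p : ℝ × ℝ => √(1 + A * p.1 ^ 2 + p.2 ^ 2) :=
    ContDiff.sqrt (by fun_prop) fun p => by positivity
  unfold barrier
  fun_prop

lemma GOU_barrier {A : ℝ} (hA : 0 ≤ A) (α k η e x y : ℝ) :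
    GOU α (barrier A k η e) (x, y) =
      -((k * (A * (1 + y ^ 2) / √(1 + A * x ^ 2 + y ^ 2) ^ 3) + η * (A * 2))
        + x ^ 2 * (k * ((1 + A * x ^ 2) / √(1 + A * x ^ 2 + y ^ 2) ^ 3) + η * 2))
      + α * (x * (k * (A * x / √(1 + A * x ^ 2 + y ^ 2)) + η * (A * (2 * x)))
        + y * (k * (y / √(1 + A * x ^ 2 + y ^ 2)) + η * (2 * y))) := by
  have e₁ : (fun t => barrier A k η e (t, y)) =
      fun t => k * √((1 + y ^ 2) + A * t ^ 2) + η * (A * t ^ 2) + (η * y ^ 2 + e) := by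
    funext t
    simp only [barrier, add_right_comm]
    ring
  have e₂ : (fun t => barrier A k η e (x, t)) =
      fun t => k * √((1 + A * x ^ 2) + 1 * t ^ 2) + η * (1 * t ^ 2) + (η * (A * x ^ 2) + e) := by
    funext t
    simp only [barrier, one_mul]
    ring
  have hc₁ : 0 < 1 + y ^ 2 := by positivity
  have hc₂ : 0 < 1 + A * x ^ 2 := by positivity
  rw [GOU_eq_deriv, e₁, e₂, deriv_deriv_barrier_section hc₁ hA,
    deriv_deriv_barrier_section hc₂ zero_le_one, deriv_barrier_section hc₁ hA,
    deriv_barrier_section hc₂ zero_le_one]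
  simp only [one_mul, add_right_comm 1 (y ^ 2) (A * x ^ 2)]

/-- The barrier is a supersolution, with the constant term absorbing the lower-order errors. -/
lemma barrier_supersolution {α δ A k η B : ℝ} (hα : 0 < α) (hδ : 0 < δ) (hA : 1 ≤ A)
    (hαA : 2 ≤ α * A) (hk : 0 ≤ k) (hη : 0 ≤ η) (x y : ℝ) :
    k * (δ + α / 2) * √(1 + A * x ^ 2 + y ^ 2) + B - k * (α + A) ≤
      δ * barrier A k η (B / δ + η * (2 * A / δ)) (x, y)
        + GOU α (barrier A k η (B / δ + η * (2 * A / δ))) (x, y) := by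
  rw [GOU_barrier (by linarith)]
  simp only [barrier]
  have hQ : 1 ≤ 1 + A * x ^ 2 + y ^ 2 := by nlinarith [sq_nonneg x, sq_nonneg y]
  have hs1 : 1 ≤ √(1 + A * x ^ 2 + y ^ 2) := Real.one_le_sqrt.2 hQ
  have hsq : √(1 + A * x ^ 2 + y ^ 2) ^ 2 = 1 + A * x ^ 2 + y ^ 2 :=
    Real.sq_sqrt (by linarith)
  set s := √(1 + A * x ^ 2 + y ^ 2) with hs
  have hs0 : 0 < s := by linarith
  have hAx : 0 ≤ A * x ^ 2 := by positivity
  have hx2 : x ^ 2 ≤ α / 2 * s ^ 2 := by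
    nlinarith [mul_le_mul_of_nonneg_right hαA (sq_nonneg x), mul_nonneg hα.le (sq_nonneg y)]
  have b₁ : A * (1 + y ^ 2) / s ^ 3 ≤ A := by
    rw [div_le_iff₀ (by positivity)]
    have : s ^ 2 ≤ s ^ 3 := pow_le_pow_right₀ hs1 (by norm_num)
    gcongr
    linarith
  have b₂ : x ^ 2 * ((1 + A * x ^ 2) / s ^ 3) ≤ α / 2 * s := by
    rw [← mul_div_assoc, div_le_iff₀ (by positivity)]
    calc x ^ 2 * (1 + A * x ^ 2) ≤ (α / 2 * s ^ 2) * s ^ 2 := by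
          gcongr
          nlinarith [sq_nonneg y]
      _ = α / 2 * s * s ^ 3 := by ring
  have b₃ : s - 1 ≤ (A * x ^ 2 + y ^ 2) / s := by
    rw [le_div_iff₀ hs0]
    nlinarith
  have b₄ : 2 * x ^ 2 ≤ 2 * α * (A * x ^ 2 + y ^ 2) := by
    nlinarith [mul_le_mul_of_nonneg_right hαA (sq_nonneg x), mul_nonneg hα.le (sq_nonneg y),
      sq_nonneg x]
  have c₀ : 0 ≤ δ * (η * (A * x ^ 2 + y ^ 2)) := by positivity
  have c₁ := mul_le_mul_of_nonneg_left b₁ hk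
  have c₂ := mul_le_mul_of_nonneg_left b₂ hk
  have c₃ := mul_le_mul_of_nonneg_left b₃ (mul_nonneg hα.le hk)
  have c₄ := mul_le_mul_of_nonneg_left b₄ hη
  have hconst : δ * (B / δ + η * (2 * A / δ)) = B + η * (2 * A) := by field_simp
  have hdiv : (A * x ^ 2 + y ^ 2) / s = x * (A * x / s) + y * (y / s) := by ring
  rw [hdiv] at c₃
  linear_combination c₀ + c₁ + c₂ + c₃ + c₄ - hconst

lemma nrm_nonneg (p : ℝ × ℝ) : 0 ≤ nrm p := Real.sqrt_nonneg _

lemma nrm_sq (p : ℝ × ℝ) : nrm p ^ 2 = p.1 ^ 2 + p.2 ^ 2 := Real.sq_sqrt (by positivity)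

lemma norm_le_nrm (p : ℝ × ℝ) : ‖p‖ ≤ nrm p := by
  rw [Prod.norm_def, max_le_iff, Real.norm_eq_abs, Real.norm_eq_abs]
  exact ⟨Real.abs_le_sqrt (by nlinarith [sq_nonneg p.2]),
    Real.abs_le_sqrt (by nlinarith [sq_nonneg p.1])⟩

/-- Comparison with the barrier. -/
lemma le_of_GOU_subsolution {α δ A k B C_F K : ℝ} (hα : 0 < α) (hδ : 0 < δ) (hA : 1 ≤ A)
    (hαA : 2 ≤ α * A) (hk : 0 ≤ k) (hCF : 0 ≤ C_F) (hkC : k * (δ + α / 2) = C_F)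
    (hB : C_F + k * (α + A) ≤ B) {u : ℝ × ℝ → ℝ} (hu : ContDiff ℝ 2 u)
    (hK : ∀ p, u p ≤ K * (1 + nrm p)) (hsub : ∀ p, δ * u p + GOU α u p ≤ C_F * (nrm p + 1))
    (p : ℝ × ℝ) : u p ≤ k * √(1 + A * p.1 ^ 2 + p.2 ^ 2) + B / δ := by
  have hA0 : 0 < A := by linarith
  have hB0 : 0 ≤ B := le_trans (by positivity) hB
  have main : ∀ η > 0, u p ≤ barrier A k η (B / δ + η * (2 * A / δ)) p := by
    intro η hη
    have hV := contDiff_barrier hA0.le k η (B / δ + η * (2 * A / δ))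
    refine sub_nonneg.1 (nonneg_of_GOU_supersolution (α := α) hδ
      (v := fun q => barrier A k η (B / δ + η * (2 * A / δ)) q - u q)
      (hV.sub hu).continuous ?_ ?_ p)
    · refine tendsto_atTop_mono (fun q => ?_)
        (tendsto_atTop_add_const_right _ (-(K + (K + 1) ^ 2 / (4 * η)))
          (tendsto_norm_cocompact_atTop (E := ℝ × ℝ)))
      have h₁ : η * nrm q ^ 2 ≤ barrier A k η (B / δ + η * (2 * A / δ)) q := by
        have hquad : nrm q ^ 2 ≤ A * q.1 ^ 2 + q.2 ^ 2 := by
          rw [nrm_sq]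
          nlinarith [mul_le_mul_of_nonneg_right hA (sq_nonneg q.1)]
        have h0 : 0 ≤ k * √(1 + A * q.1 ^ 2 + q.2 ^ 2) := by positivity
        have h0' : 0 ≤ B / δ + η * (2 * A / δ) := by positivity
        have := mul_le_mul_of_nonneg_left hquad hη.le
        unfold barrier
        linarith
      have h₂ : (K + 1) * nrm q - (K + 1) ^ 2 / (4 * η) ≤ η * nrm q ^ 2 := by
        rw [sub_le_iff_le_add, ← sub_nonneg]
        have : η * nrm q ^ 2 + (K + 1) ^ 2 / (4 * η) - (K + 1) * nrm q
            = (2 * η * nrm q - (K + 1)) ^ 2 / (4 * η) := by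
          field_simp
          ring
        rw [this]
        positivity
      have h₃ := hK q
      have h₄ := norm_le_nrm q
      linarith
    · rintro ⟨x, y⟩
      rw [GOU_sub α hV hu]
      have h₁ := barrier_supersolution (B := B) hα hδ hA hαA hk hη.le x y
      rw [hkC] at h₁
      have h₂ := hsub (x, y)
      have h₃ : nrm (x, y) ≤ √(1 + A * x ^ 2 + y ^ 2) :=
        Real.sqrt_le_sqrt (by nlinarith [mul_le_mul_of_nonneg_right hA (sq_nonneg x)])
      have h₄ := mul_le_mul_of_nonneg_left h₃ hCF
      linarith
  refine le_of_forall_pos_le_add fun ε hε => ?_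
  have hQ : 0 < A * p.1 ^ 2 + p.2 ^ 2 + 2 * A / δ := by positivity
  have h := main (ε / (A * p.1 ^ 2 + p.2 ^ 2 + 2 * A / δ)) (by positivity)
  have he := div_mul_cancel₀ ε hQ.ne'
  unfold barrier at h
  linarith

lemma sqrt_le_one_add_mul_nrm {A : ℝ} (hA : 1 ≤ A) (p : ℝ × ℝ) :
    √(1 + A * p.1 ^ 2 + p.2 ^ 2) ≤ 1 + A * nrm p := by
  have hn := nrm_nonneg p
  have hsq := nrm_sq p
  have hA0 : 0 ≤ A := by linarith
  refine Real.sqrt_le_iff.2 ⟨by positivity, ?_⟩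
  have h₁ : p.2 ^ 2 ≤ A * p.2 ^ 2 := le_mul_of_one_le_left (sq_nonneg _) hA
  have h₂ : A * nrm p ^ 2 ≤ A * (A * nrm p ^ 2) :=
    mul_le_mul_of_nonneg_left (le_mul_of_one_le_left (sq_nonneg _) hA) hA0
  have h₃ : 0 ≤ A * nrm p := by positivity
  calc 1 + A * p.1 ^ 2 + p.2 ^ 2 ≤ 1 + A * nrm p ^ 2 := by rw [hsq]; linarith
    _ ≤ (1 + A * nrm p) ^ 2 := by linarith

/-- Growth bound of order `|y| + 1/δ` for solutions of the approximated ergodic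
problem `δu − Δ_G u + αy·∇u = F`, with constant depending only on `α, C_F`. -/
theorem approx_corrector_growth (α C_F : ℝ) (hα : 0 < α) (hCF : 0 < C_F) :
    ∃ C > (0 : ℝ), ∀ F : ℝ × ℝ → ℝ, Continuous F →
      (∀ y : ℝ × ℝ, |F y| ≤ C_F * (nrm y + 1)) →
      ∀ δ > (0 : ℝ), ∀ u : ℝ × ℝ → ℝ, ContDiff ℝ 2 u →
        (∃ K > (0 : ℝ), ∀ y : ℝ × ℝ, |u y| ≤ K * (1 + nrm y)) →
        (∀ y : ℝ × ℝ, δ * u y + GOU α u y = F y) →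
        ∀ y : ℝ × ℝ, |u y| ≤ C * (nrm y + 1 / δ) := by
  obtain ⟨A, hA, hαA⟩ : ∃ A : ℝ, 1 ≤ A ∧ 2 ≤ α * A := by
    refine ⟨1 + 2 / α, by linarith [div_pos two_pos hα], ?_⟩
    have : α * (1 + 2 / α) = α + 2 := by field_simp
    linarith
  have hA0 : 0 < A := by linarith
  set M := 2 * C_F / α with hM
  have hM0 : 0 < M := by positivity
  set B := C_F + M * (α + A) with hB
  have hB0 : 0 < B := by positivity
  refine ⟨M * A + C_F + B, by positivity, ?_⟩
  intro F _ hF δ hδ u hu ⟨K, _, hK⟩ heq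
  set k := C_F / (δ + α / 2) with hk
  have hk0 : 0 < k := by positivity
  have hkC : k * (δ + α / 2) = C_F := div_mul_cancel₀ _ (by positivity)
  have hkM : k ≤ M := by
    rw [hM, le_div_iff₀ hα]
    nlinarith
  have hkδ : k ≤ C_F / δ := by
    rw [le_div_iff₀ hδ]
    nlinarith
  have hkB : C_F + k * (α + A) ≤ B := by
    rw [hB]
    gcongr
  intro y
  have upper := le_of_GOU_subsolution hα hδ hA hαA hk0.le hCF.le hkC hkB hu
    (fun p => (le_abs_self _).trans (hK p))
    (fun p => (heq p).le.trans ((le_abs_self _).trans (hF p))) y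
  have lower := le_of_GOU_subsolution hα hδ hA hαA hk0.le hCF.le hkC hkB hu.neg
    (fun p => (neg_le_abs _).trans (hK p))
    (fun p => by
      have h₁ := heq p
      have h₂ := (neg_le_abs _).trans (hF p)
      have h₃ := GOU_neg α u p
      change δ * -u p + GOU α (fun q => -u q) p ≤ _
      linarith) y
  have hn := nrm_nonneg y
  have hW : k * √(1 + A * y.1 ^ 2 + y.2 ^ 2) + B / δ ≤ (M * A + C_F + B) * (nrm y + 1 / δ) := by
    have h₁ := mul_le_mul_of_nonneg_left (sqrt_le_one_add_mul_nrm hA y) hk0.le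
    have h₂ : k * (A * nrm y) ≤ M * (A * nrm y) := by gcongr
    have h₃ : 0 ≤ (C_F + B) * nrm y + M * A * (1 / δ) := by positivity
    have h₄ : (C_F + B) * (1 / δ) = C_F / δ + B / δ := by ring
    linarith
  exact abs_le'.2 ⟨upper.trans hW, lower.trans hW⟩
end

section
/- Let α₁ > 1, α₂ > 0, δ > 0, and let F : ℝ² → ℝ be Lipschitz continuous with Lipschitz constant L. Set l = min{α₁ − 1, α₂}. Let u : ℝ² → ℝ be twice continuously differentiable, satisfy |u(y)| ≤ C₀(|y| + 1/δ) for all y ∈ ℝ² for some C₀ > 0, and solve δ u(y) − (∂²u/∂y₁²(y) + y₁² ∂²u/∂y₂²(y)) + α₁ y₁ ∂u/∂y₁(y) + α₂ y₂ ∂u/∂y₂(y) = F(y) for all y ∈ ℝ². Then for every L̄ > L/l one has |u(x) − u(y)| ≤ L̄ |x − y| for all x, y ∈ ℝ². -/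
/-- The Grushin operator with anisotropic Ornstein–Uhlenbeck drift
`u ↦ −(∂²u/∂y₁² + y₁² ∂²u/∂y₂²) + α₁ y₁ ∂u/∂y₁ + α₂ y₂ ∂u/∂y₂`. -/
noncomputable def GOU2 (α₁ α₂ : ℝ) (u : ℝ × ℝ → ℝ) (p : ℝ × ℝ) : ℝ :=
  -(pd11 u p + p.1 ^ 2 * pd22 u p) + α₁ * p.1 * pd1 u p + α₂ * p.2 * pd2 u p

/-- A function of one real variable has nonpositive second derivative at a global maximum. -/
theorem second_deriv_nonpos_of_forall_le {g g' : ℝ → ℝ} {g'' a : ℝ}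
    (hg : ∀ t, HasDerivAt g (g' t) t) (hg' : HasDerivAt g' g'' a)
    (hmax : ∀ t, g t ≤ g a) : g' a = 0 ∧ g'' ≤ 0 := by
  have hd : deriv g = g' := funext fun t => (hg t).deriv
  have hloc : IsLocalMax g a := Filter.Eventually.of_forall hmax
  have h0 : g' a = 0 := hloc.hasDerivAt_eq_zero (hg a)
  refine ⟨h0, ?_⟩
  by_contra! hpos
  have hmin : IsLocalMin g a := by
    refine isLocalMin_of_deriv_deriv_pos ?_ ?_ (hg a).continuousAt
    · rwa [hd, hg'.deriv]
    · rwa [hd]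
  have hconst : g =ᶠ[nhds a] fun _ => g a :=
    hmin.mono fun t ht => le_antisymm (hmax t) ht
  have hderiv := hconst.deriv
  rw [hd] at hderiv
  have hzero : g' =ᶠ[nhds a] fun _ => (0 : ℝ) := by
    filter_upwards [hderiv] with t ht
    simpa using ht
  have := hzero.deriv_eq
  rw [hg'.deriv] at this
  simp at this
  linarith

/-- First and second order conditions for `a(s + σ t) - b(r + τ t)` touched from above by a
quadratic polynomial at `t = 0`. -/
theorem optimality_of_le_quadratic {a b : ℝ → ℝ} (ha : ContDiff ℝ 2 a) (hb : ContDiff ℝ 2 b)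
    (s r σ τ q₁ q₂ : ℝ)
    (hle : ∀ t, a (s + σ * t) - b (r + τ * t) ≤ a s - b r + q₁ * t + q₂ * t ^ 2) :
    σ * deriv a s - τ * deriv b r = q₁ ∧
      σ ^ 2 * deriv (deriv a) s - τ ^ 2 * deriv (deriv b) r ≤ 2 * q₂ := by
  have hline : ∀ k m t : ℝ, HasDerivAt (fun t => k + m * t) m t := fun k m t => by
    simpa using ((hasDerivAt_id t).const_mul m).const_add k
  have hfirst : ∀ {f : ℝ → ℝ}, ContDiff ℝ 2 f → ∀ k m t : ℝ,
      HasDerivAt (fun t => f (k + m * t)) (deriv f (k + m * t) * m) t := fun hf k m t =>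
    ((hf.differentiable (by norm_num)) (k + m * t)).hasDerivAt.comp t (hline k m t)
  have hsecond : ∀ {f : ℝ → ℝ}, ContDiff ℝ 2 f → ∀ k m t : ℝ,
      HasDerivAt (fun t => deriv f (k + m * t)) (deriv (deriv f) (k + m * t) * m) t :=
    fun {f} hf k m t => by
      have hf' : ContDiff ℝ 1 (deriv f) := by
        have : ContDiff ℝ (1 + 1) f := by simpa [one_add_one_eq_two] using hf
        exact (contDiff_succ_iff_deriv.1 this).2.2
      exact ((hf'.differentiable (by norm_num)) (k + m * t)).hasDerivAt.comp t (hline k m t)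
  have hquad : ∀ t : ℝ, HasDerivAt (fun t => q₁ * t + q₂ * t ^ 2) (q₁ + 2 * q₂ * t) t :=
    fun t => by
      refine (((hasDerivAt_id t).const_mul q₁).add
        ((hasDerivAt_pow 2 t).const_mul q₂)).congr_deriv ?_
      norm_num
      ring
  have key := second_deriv_nonpos_of_forall_le (a := 0)
    (fun t => ((hfirst ha s σ t).sub (hfirst hb r τ t)).sub (hquad t))
    ((((hsecond ha s σ 0).mul_const σ).sub ((hsecond hb r τ 0).mul_const τ)).sub
      (hline q₁ (2 * q₂) 0))
    (fun t => by
      have := hle t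
      simp only [Pi.sub_apply, mul_zero, add_zero]
      norm_num
      linarith)
  simp only [mul_zero, add_zero] at key
  constructor
  · linarith [key.1]
  · linarith [key.2]

/-- A continuous function of two points of the plane with at most linear growth, penalized
by a multiple of the squared Euclidean norms, attains its maximum. -/
theorem exists_forall_penalized_le {Φ : (ℝ × ℝ) × (ℝ × ℝ) → ℝ} (hΦ : Continuous Φ) {A B ε : ℝ}
    (hε : 0 < ε) (hgrowth : ∀ p, Φ p ≤ A * (nrm p.1 + nrm p.2) + B) :
    ∃ q, ∀ p : (ℝ × ℝ) × (ℝ × ℝ), Φ p - ε * (p.1.1 ^ 2 + p.1.2 ^ 2 + p.2.1 ^ 2 + p.2.2 ^ 2) ≤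
      Φ q - ε * (q.1.1 ^ 2 + q.1.2 ^ 2 + q.2.1 ^ 2 + q.2.2 ^ 2) := by
  refine Continuous.exists_forall_ge (by fun_prop) ?_
  have hlim : Filter.Tendsto (fun p : (ℝ × ℝ) × (ℝ × ℝ) => (A ^ 2 / ε + B) - ε / 2 * ‖p‖ ^ 2)
      (Filter.cocompact _) Filter.atBot := by
    have h1 : Filter.Tendsto (fun p : (ℝ × ℝ) × (ℝ × ℝ) => ‖p‖ ^ 2)
        (Filter.cocompact _) Filter.atTop :=
      (Filter.tendsto_pow_atTop two_ne_zero).comp (tendsto_norm_cocompact_atTop)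
    have h2 := Filter.tendsto_neg_atTop_atBot.comp (h1.const_mul_atTop (half_pos hε))
    simpa [sub_eq_add_neg, Function.comp_def] using
      Filter.tendsto_atBot_add_const_left _ (A ^ 2 / ε + B) h2
  refine Filter.tendsto_atBot_mono (fun p => ?_) hlim
  obtain ⟨⟨a, b⟩, c, d⟩ := p
  have hsq : ∀ x y : ℝ, A * nrm (x, y) ≤ A ^ 2 / (2 * ε) + ε / 2 * (x ^ 2 + y ^ 2) := by
    intro x y
    have h : nrm (x, y) ^ 2 = x ^ 2 + y ^ 2 := Real.sq_sqrt (by positivity)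
    rw [← h]
    have : A ^ 2 / (2 * ε) + ε / 2 * nrm (x, y) ^ 2 - A * nrm (x, y) =
        (A - ε * nrm (x, y)) ^ 2 / (2 * ε) := by
      field_simp; ring
    have : 0 ≤ (A - ε * nrm (x, y)) ^ 2 / (2 * ε) := by positivity
    linarith
  have hnorm : ‖(((a, b), (c, d)) : (ℝ × ℝ) × (ℝ × ℝ))‖ ^ 2 ≤ a ^ 2 + b ^ 2 + c ^ 2 + d ^ 2 := by
    refine (Real.le_sqrt (norm_nonneg _) (by positivity)).1 ?_
    simp only [Prod.norm_def, Real.norm_eq_abs, sup_le_iff]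
    refine ⟨⟨?_, ?_⟩, ?_, ?_⟩ <;> refine Real.abs_le_sqrt ?_ <;> nlinarith [sq_nonneg a,
      sq_nonneg b, sq_nonneg c, sq_nonneg d]
  have hA : A ^ 2 / (2 * ε) + A ^ 2 / (2 * ε) = A ^ 2 / ε := by field_simp; ring
  have := hgrowth ((a, b), (c, d))
  have := mul_le_mul_of_nonneg_left hnorm (half_pos hε).le
  have := hsq a b
  have := hsq c d
  simp only at *
  linarith

/-- At a maximum point `(x, y)` of `u(x) - u(y) - c |x - y|² - ε (|x|² + |y|²)`, the difference of
the operator values is bounded below by the contribution of the quadratic test function. -/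
theorem le_GOU2_sub_GOU2_of_max {u : ℝ × ℝ → ℝ} (hu : ContDiff ℝ 2 u) {α₁ α₂ c ε : ℝ}
    (x₁ x₂ y₁ y₂ : ℝ)
    (hmax : ∀ a₁ a₂ b₁ b₂ : ℝ,
      u (a₁, a₂) - u (b₁, b₂) - c * ((a₁ - b₁) ^ 2 + (a₂ - b₂) ^ 2)
          - ε * (a₁ ^ 2 + a₂ ^ 2 + b₁ ^ 2 + b₂ ^ 2) ≤
        u (x₁, x₂) - u (y₁, y₂) - c * ((x₁ - y₁) ^ 2 + (x₂ - y₂) ^ 2)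
          - ε * (x₁ ^ 2 + x₂ ^ 2 + y₁ ^ 2 + y₂ ^ 2)) :
    2 * c * ((α₁ - 1) * (x₁ - y₁) ^ 2 + α₂ * (x₂ - y₂) ^ 2)
        + 2 * ε * ((α₁ - 1) * (x₁ ^ 2 + y₁ ^ 2) + α₂ * (x₂ ^ 2 + y₂ ^ 2)) - 4 * ε ≤
      GOU2 α₁ α₂ u (x₁, x₂) - GOU2 α₁ α₂ u (y₁, y₂) := by
  have hfst : ∀ s : ℝ, ContDiff ℝ 2 (fun t => u (t, s)) := fun s => by fun_prop
  have hsnd : ∀ s : ℝ, ContDiff ℝ 2 (fun t => u (s, t)) := fun s => by fun_prop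
  obtain ⟨hx₁, -⟩ := optimality_of_le_quadratic (hfst x₂) (hfst y₂) x₁ y₁ 1 0
    (2 * c * (x₁ - y₁) + 2 * ε * x₁) (c + ε) fun t => by
      have := hmax (x₁ + 1 * t) x₂ (y₁ + 0 * t) y₂
      linarith
  obtain ⟨hy₁, -⟩ := optimality_of_le_quadratic (hfst x₂) (hfst y₂) x₁ y₁ 0 1
    (-(2 * c * (x₁ - y₁)) + 2 * ε * y₁) (c + ε) fun t => by
      have := hmax (x₁ + 0 * t) x₂ (y₁ + 1 * t) y₂
      linarith
  obtain ⟨hx₂, -⟩ := optimality_of_le_quadratic (hsnd x₁) (hsnd y₁) x₂ y₂ 1 0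
    (2 * c * (x₂ - y₂) + 2 * ε * x₂) (c + ε) fun t => by
      have := hmax x₁ (x₂ + 1 * t) y₁ (y₂ + 0 * t)
      linarith
  obtain ⟨hy₂, -⟩ := optimality_of_le_quadratic (hsnd x₁) (hsnd y₁) x₂ y₂ 0 1
    (-(2 * c * (x₂ - y₂)) + 2 * ε * y₂) (c + ε) fun t => by
      have := hmax x₁ (x₂ + 0 * t) y₁ (y₂ + 1 * t)
      linarith
  obtain ⟨-, h₁₁⟩ := optimality_of_le_quadratic (hfst x₂) (hfst y₂) x₁ y₁ 1 1
    (2 * ε * (x₁ + y₁)) (2 * ε) fun t => by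
      have := hmax (x₁ + 1 * t) x₂ (y₁ + 1 * t) y₂
      linarith
  obtain ⟨-, h₂₂⟩ := optimality_of_le_quadratic (hsnd x₁) (hsnd y₁) x₂ y₂ x₁ y₁
    (2 * c * (x₂ - y₂) * (x₁ - y₁) + 2 * ε * (x₁ * x₂ + y₁ * y₂))
    (c * (x₁ - y₁) ^ 2 + ε * (x₁ ^ 2 + y₁ ^ 2)) fun t => by
      have := hmax x₁ (x₂ + x₁ * t) y₁ (y₂ + y₁ * t)
      linarith
  change 1 * pd1 u (x₁, x₂) - 0 * pd1 u (y₁, y₂) = _ at hx₁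
  change 0 * pd1 u (x₁, x₂) - 1 * pd1 u (y₁, y₂) = _ at hy₁
  change 1 * pd2 u (x₁, x₂) - 0 * pd2 u (y₁, y₂) = _ at hx₂
  change 0 * pd2 u (x₁, x₂) - 1 * pd2 u (y₁, y₂) = _ at hy₂
  change 1 ^ 2 * pd11 u (x₁, x₂) - 1 ^ 2 * pd11 u (y₁, y₂) ≤ _ at h₁₁
  change x₁ ^ 2 * pd22 u (x₁, x₂) - y₁ ^ 2 * pd22 u (y₁, y₂) ≤ _ at h₂₂
  have ex₁ : pd1 u (x₁, x₂) = 2 * c * (x₁ - y₁) + 2 * ε * x₁ := by linarith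
  have ey₁ : pd1 u (y₁, y₂) = 2 * c * (x₁ - y₁) - 2 * ε * y₁ := by linarith
  have ex₂ : pd2 u (x₁, x₂) = 2 * c * (x₂ - y₂) + 2 * ε * x₂ := by linarith
  have ey₂ : pd2 u (y₁, y₂) = 2 * c * (x₂ - y₂) - 2 * ε * y₂ := by linarith
  simp only [GOU2, ex₁, ey₁, ex₂, ey₂]
  linarith

/-- Global Lipschitz continuity of the approximated corrector for the
anisotropic drift `b(y) = (−α₁y₁, −α₂y₂)` with `α₁ > 1`, `α₂ > 0`:
`u` is `L̄`-Lipschitz for every `L̄ > L/l` with `l = min{α₁−1, α₂}`. -/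
theorem approx_corrector_lipschitz_anisotropic (α₁ α₂ δ L : ℝ)
    (hα₁ : 1 < α₁) (hα₂ : 0 < α₂) (hδ : 0 < δ) (hL : 0 ≤ L)
    (F : ℝ × ℝ → ℝ)
    (hF : ∀ x y : ℝ × ℝ, |F x - F y| ≤ L * nrm (x - y))
    (u : ℝ × ℝ → ℝ) (hu : ContDiff ℝ 2 u)
    (C₀ : ℝ) (hC₀ : 0 < C₀)
    (hgrowth : ∀ y : ℝ × ℝ, |u y| ≤ C₀ * (nrm y + 1 / δ))
    (hpde : ∀ y : ℝ × ℝ, δ * u y + GOU2 α₁ α₂ u y = F y) :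
    ∀ L' : ℝ, L / min (α₁ - 1) α₂ < L' →
      ∀ x y : ℝ × ℝ, |u x - u y| ≤ L' * nrm (x - y) := by
  intro L' hL'
  set l := min (α₁ - 1) α₂ with hl
  have hlpos : 0 < l := lt_min (by linarith) hα₂
  have hL'nn : 0 ≤ L' := (div_nonneg hL hlpos.le).trans hL'.le
  have hLl : L ≤ L' * l := ((div_lt_iff₀ hlpos).1 hL').le
  have hl₁ : l ≤ α₁ - 1 := min_le_left _ _
  have hl₂ : l ≤ α₂ := min_le_right _ _
  have nrm_nonneg : ∀ p, 0 ≤ nrm p := fun p => Real.sqrt_nonneg _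
  have nrm_sq : ∀ p, nrm p ^ 2 = p.1 ^ 2 + p.2 ^ 2 := fun p => Real.sq_sqrt (by positivity)
  have hnrm : Continuous nrm := by unfold nrm; fun_prop
  have hucont : Continuous u := hu.continuous
  have penalized : ∀ ε : ℝ, 0 < ε → ∀ x y : ℝ × ℝ,
      u x - u y - L' * nrm (x - y) ≤
        ε * (4 / δ + (x.1 ^ 2 + x.2 ^ 2 + y.1 ^ 2 + y.2 ^ 2)) := by
    intro ε hε x y
    obtain ⟨⟨⟨x₁, x₂⟩, y₁, y₂⟩, hq⟩ := exists_forall_penalized_le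
      (Φ := fun p => u p.1 - u p.2 - L' * nrm (p.1 - p.2)) (A := C₀) (B := 2 * C₀ / δ)
      (by fun_prop) hε (fun p => by
        have h1 := le_of_abs_le (hgrowth p.1)
        have h2 := neg_le_of_abs_le (hgrowth p.2)
        have h3 := mul_nonneg hL'nn (nrm_nonneg (p.1 - p.2))
        have h4 : 2 * C₀ / δ = C₀ * (1 / δ) + C₀ * (1 / δ) := by ring
        linarith)
    set r := nrm ((x₁, x₂) - (y₁, y₂)) with hr
    have hxy := hq (x, y)
    suffices h : u (x₁, x₂) - u (y₁, y₂) - L' * r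
        - ε * (x₁ ^ 2 + x₂ ^ 2 + y₁ ^ 2 + y₂ ^ 2) ≤ 4 * ε / δ by
      have : ε * (4 / δ) = 4 * ε / δ := by ring
      linarith
    by_contra! hM
    have hpen : 0 ≤ ε * (x₁ ^ 2 + x₂ ^ 2 + y₁ ^ 2 + y₂ ^ 2) := by positivity
    have hr0 : 0 ≤ r := nrm_nonneg _
    have hLr : 0 ≤ L' * r := mul_nonneg hL'nn hr0
    have hr2 : r ^ 2 = (x₁ - y₁) ^ 2 + (x₂ - y₂) ^ 2 := nrm_sq _
    have hdiff : 4 * ε / δ < u (x₁, x₂) - u (y₁, y₂) := by linarith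
    have hrpos : 0 < r := by
      refine lt_of_le_of_ne hr0 fun h => ?_
      rw [← h] at hr2
      have e1 : x₁ = y₁ := by nlinarith [sq_nonneg (x₁ - y₁), sq_nonneg (x₂ - y₂)]
      have e2 : x₂ = y₂ := by nlinarith [sq_nonneg (x₁ - y₁), sq_nonneg (x₂ - y₂)]
      rw [e1, e2, sub_self] at hdiff
      have : 0 < 4 * ε / δ := by positivity
      linarith
    have hop := le_GOU2_sub_GOU2_of_max (α₁ := α₁) (α₂ := α₂) (c := L' / (2 * r)) (ε := ε)
      hu x₁ x₂ y₁ y₂ fun a₁ a₂ b₁ b₂ => by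
        have h1 := hq ((a₁, a₂), (b₁, b₂))
        dsimp only at h1
        have h2 : nrm ((a₁, a₂) - (b₁, b₂)) ^ 2 = (a₁ - b₁) ^ 2 + (a₂ - b₂) ^ 2 := nrm_sq _
        rw [← h2, ← hr2]
        set s := nrm ((a₁, a₂) - (b₁, b₂))
        have h3 : L' / (2 * r) * s ^ 2 - L' / (2 * r) * r ^ 2 - (L' * s - L' * r) =
            L' / (2 * r) * (s - r) ^ 2 := by
          field_simp; ring
        have h4 : 0 ≤ L' / (2 * r) * (s - r) ^ 2 := by positivity
        linarith
    have hdrift : L' * l * r ≤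
        2 * (L' / (2 * r)) * ((α₁ - 1) * (x₁ - y₁) ^ 2 + α₂ * (x₂ - y₂) ^ 2) := by
      have h1 : L' * l * r = 2 * (L' / (2 * r)) * (l * r ^ 2) := by field_simp
      rw [h1, hr2, mul_add]
      gcongr
    have hlyap : 0 ≤ 2 * ε * ((α₁ - 1) * (x₁ ^ 2 + y₁ ^ 2) + α₂ * (x₂ ^ 2 + y₂ ^ 2)) := by
      have : 0 ≤ α₁ - 1 := by linarith
      positivity
    have hFr := le_of_abs_le (hF (x₁, x₂) (y₁, y₂))
    rw [← hr] at hFr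
    have hLr' := mul_le_mul_of_nonneg_right hLl hr0
    have hpx := hpde (x₁, x₂)
    have hpy := hpde (y₁, y₂)
    rw [div_lt_iff₀ hδ] at hdiff
    linarith
  have oneSided : ∀ x y : ℝ × ℝ, u x - u y ≤ L' * nrm (x - y) := by
    intro x y
    have hlim : Filter.Tendsto
        (fun ε : ℝ => ε * (4 / δ + (x.1 ^ 2 + x.2 ^ 2 + y.1 ^ 2 + y.2 ^ 2)))
        (nhdsWithin 0 (Set.Ioi 0)) (nhds 0) := by
      have : Continuous fun ε : ℝ => ε * (4 / δ + (x.1 ^ 2 + x.2 ^ 2 + y.1 ^ 2 + y.2 ^ 2)) := by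
        fun_prop
      simpa using (this.tendsto 0).mono_left nhdsWithin_le_nhds
    have := ge_of_tendsto hlim (Filter.eventually_of_mem self_mem_nhdsWithin
      fun ε hε => penalized ε hε x y)
    linarith
  intro x y
  refine abs_sub_le_iff.2 ⟨oneSided x y, ?_⟩
  have hsymm : nrm (y - x) = nrm (x - y) := by
    simp only [nrm, Prod.fst_sub, Prod.snd_sub]
    congr 1
    ring
  exact hsymm ▸ oneSided y x
end

section
/- Let α > 0 and C_F > 0. Then there exist constants C₁ > 0 and R > 0 such that, defining g(y) = C₁ log(y₁⁴ + y₂²) for y ∈ ℝ² \ {0}, one has for every δ ≥ 0 and every y ∈ ℝ² with |y| ≥ R: δ g(y) − (∂²g/∂y₁²(y) + y₁² ∂²g/∂y₂²(y)) + α y·∇g(y) ≥ C_F. In particular, for every y ≠ 0 the left-hand side with δ = 0 equals C₁[(2y₁⁶ − 10 y₁² y₂²)/(y₁⁴ + y₂²)² + α(4y₁⁴ + 2y₂²)/(y₁⁴ + y₂²)]. -/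
theorem quartic_add_sq_pos {y : ℝ × ℝ} (hy : y ≠ 0) : 0 < y.1 ^ 4 + y.2 ^ 2 := by
  by_contra! h
  have h₁ : y.1 ^ 4 = 0 := by nlinarith [sq_nonneg (y.1 ^ 2), sq_nonneg y.2]
  have h₂ : y.2 ^ 2 = 0 := by nlinarith [sq_nonneg (y.1 ^ 2), sq_nonneg y.2]
  exact hy (Prod.ext (pow_eq_zero_iff (by norm_num) |>.1 h₁) (pow_eq_zero_iff (by norm_num) |>.1 h₂))

theorem hasDerivAt_quartic_add (a t : ℝ) :
    HasDerivAt (fun t : ℝ => t ^ 4 + a) (4 * t ^ 3) t := by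
  simpa using (hasDerivAt_pow 4 t).add_const a

theorem hasDerivAt_add_sq (a t : ℝ) :
    HasDerivAt (fun t : ℝ => a + t ^ 2) (2 * t) t := by
  simpa using (hasDerivAt_pow 2 t).const_add a

theorem pd1_log_quartic {C : ℝ} {g : ℝ × ℝ → ℝ}
    (hg : ∀ y : ℝ × ℝ, g y = C * Real.log (y.1 ^ 4 + y.2 ^ 2)) {y : ℝ × ℝ} (hy : y ≠ 0) :
    pd1 g y = C * (4 * y.1 ^ 3 / (y.1 ^ 4 + y.2 ^ 2)) := by
  simp only [pd1, hg]
  exact (((hasDerivAt_quartic_add _ _).log (quartic_add_sq_pos hy).ne').const_mul C).deriv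

theorem pd2_log_quartic {C : ℝ} {g : ℝ × ℝ → ℝ}
    (hg : ∀ y : ℝ × ℝ, g y = C * Real.log (y.1 ^ 4 + y.2 ^ 2)) {y : ℝ × ℝ} (hy : y ≠ 0) :
    pd2 g y = C * (2 * y.2 / (y.1 ^ 4 + y.2 ^ 2)) := by
  simp only [pd2, hg]
  exact (((hasDerivAt_add_sq _ _).log (quartic_add_sq_pos hy).ne').const_mul C).deriv

theorem pd11_log_quartic {C : ℝ} {g : ℝ × ℝ → ℝ}
    (hg : ∀ y : ℝ × ℝ, g y = C * Real.log (y.1 ^ 4 + y.2 ^ 2)) {y : ℝ × ℝ} (hy : y ≠ 0) :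
    pd11 g y = C * ((12 * y.1 ^ 2 * (y.1 ^ 4 + y.2 ^ 2) - 4 * y.1 ^ 3 * (4 * y.1 ^ 3)) /
      (y.1 ^ 4 + y.2 ^ 2) ^ 2) := by
  have hev : (fun t => pd1 g (t, y.2)) =ᶠ[nhds y.1]
      fun t => C * (4 * t ^ 3 / (t ^ 4 + y.2 ^ 2)) := by
    have hc : ContinuousAt (fun t : ℝ => (t, y.2)) y.1 := by fun_prop
    filter_upwards [hc.eventually_ne hy] with t ht
    exact pd1_log_quartic hg ht
  have hn : HasDerivAt (fun t : ℝ => 4 * t ^ 3) (12 * y.1 ^ 2) y.1 := by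
    refine ((hasDerivAt_pow 3 y.1).const_mul 4).congr_deriv ?_
    norm_num
    ring
  rw [pd11, hev.deriv_eq]
  exact ((hn.div (hasDerivAt_quartic_add _ _) (quartic_add_sq_pos hy).ne').const_mul C).deriv

theorem pd22_log_quartic {C : ℝ} {g : ℝ × ℝ → ℝ}
    (hg : ∀ y : ℝ × ℝ, g y = C * Real.log (y.1 ^ 4 + y.2 ^ 2)) {y : ℝ × ℝ} (hy : y ≠ 0) :
    pd22 g y = C * ((2 * (y.1 ^ 4 + y.2 ^ 2) - 2 * y.2 * (2 * y.2)) /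
      (y.1 ^ 4 + y.2 ^ 2) ^ 2) := by
  have hev : (fun t => pd2 g (y.1, t)) =ᶠ[nhds y.2]
      fun t => C * (2 * t / (y.1 ^ 4 + t ^ 2)) := by
    have hc : ContinuousAt (fun t : ℝ => (y.1, t)) y.2 := by fun_prop
    filter_upwards [hc.eventually_ne hy] with t ht
    exact pd2_log_quartic hg ht
  have hn : HasDerivAt (fun t : ℝ => 2 * t) 2 y.2 := by
    simpa using (hasDerivAt_id y.2).const_mul 2
  rw [pd22, hev.deriv_eq]
  exact ((hn.div (hasDerivAt_add_sq _ _) (quartic_add_sq_pos hy).ne').const_mul C).deriv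

theorem GOU_log_quartic {C : ℝ} {g : ℝ × ℝ → ℝ}
    (hg : ∀ y : ℝ × ℝ, g y = C * Real.log (y.1 ^ 4 + y.2 ^ 2)) {y : ℝ × ℝ} (hy : y ≠ 0) (α : ℝ) :
    GOU α g y = C * ((2 * y.1 ^ 6 - 10 * y.1 ^ 2 * y.2 ^ 2) / (y.1 ^ 4 + y.2 ^ 2) ^ 2
      + α * (4 * y.1 ^ 4 + 2 * y.2 ^ 2) / (y.1 ^ 4 + y.2 ^ 2)) := by
  have hD := (quartic_add_sq_pos hy).ne'
  rw [GOU, pd1_log_quartic hg hy, pd2_log_quartic hg hy, pd11_log_quartic hg hy,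
    pd22_log_quartic hg hy]
  field_simp
  ring

/-- Where `10 y₁² ≤ α (y₁⁴ + y₂²)`, the drift term dominates the diffusion term. -/
theorem le_drift_add_diffusion {α a b : ℝ} (hα : 0 < α) (hD : 0 < a ^ 4 + b ^ 2)
    (h : 10 * a ^ 2 ≤ α * (a ^ 4 + b ^ 2)) :
    α ≤ (2 * a ^ 6 - 10 * a ^ 2 * b ^ 2) / (a ^ 4 + b ^ 2) ^ 2
      + α * (4 * a ^ 4 + 2 * b ^ 2) / (a ^ 4 + b ^ 2) := by
  have h₁ : -α ≤ (2 * a ^ 6 - 10 * a ^ 2 * b ^ 2) / (a ^ 4 + b ^ 2) ^ 2 := by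
    rw [le_div_iff₀ (by positivity)]
    have := mul_le_mul_of_nonneg_right h hD.le
    have : 0 ≤ a ^ 6 := by positivity
    linarith
  have h₂ : 2 * α ≤ α * (4 * a ^ 4 + 2 * b ^ 2) / (a ^ 4 + b ^ 2) := by
    rw [le_div_iff₀ hD]
    have : 0 ≤ α * a ^ 4 := by positivity
    linarith
  linarith

/-- The logarithmic supersolution: there are `C₁ > 0` and `R > 0` such that
`g(y) = C₁ log(y₁⁴ + y₂²)` satisfies `δg − Δ_G g + αy·∇g ≥ C_F` for all
`δ ≥ 0` and `|y| ≥ R`; moreover for every `y ≠ 0` the left-hand side with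
`δ = 0` equals
`C₁[(2y₁⁶ − 10y₁²y₂²)/(y₁⁴+y₂²)² + α(4y₁⁴+2y₂²)/(y₁⁴+y₂²)]`. -/
theorem log_supersolution (α C_F : ℝ) (hα : 0 < α) (hCF : 0 < C_F) :
    ∃ C₁ > (0 : ℝ), ∃ R > (0 : ℝ), ∀ g : ℝ × ℝ → ℝ,
      (∀ y : ℝ × ℝ, g y = C₁ * Real.log (y.1 ^ 4 + y.2 ^ 2)) →
      (∀ δ : ℝ, 0 ≤ δ → ∀ y : ℝ × ℝ, R ≤ nrm y → C_F ≤ δ * g y + GOU α g y) ∧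
      (∀ y : ℝ × ℝ, y ≠ 0 →
        GOU α g y =
          C₁ * ((2 * y.1 ^ 6 - 10 * y.1 ^ 2 * y.2 ^ 2) / (y.1 ^ 4 + y.2 ^ 2) ^ 2
            + α * (4 * y.1 ^ 4 + 2 * y.2 ^ 2) / (y.1 ^ 4 + y.2 ^ 2))) := by
  refine ⟨C_F / α, by positivity, 5 / α + 2, by positivity, fun g hg =>
    ⟨fun δ hδ y hy => ?_, fun y hy => GOU_log_quartic hg hy α⟩⟩
  obtain ⟨k, hk⟩ : ∃ k, k = 5 / α := ⟨_, rfl⟩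
  have hk_pos : 0 < k := by rw [hk]; positivity
  have hαk : α * k = 5 := by rw [hk]; field_simp
  have hR : (k + 2) ^ 2 ≤ y.1 ^ 2 + y.2 ^ 2 := by
    rw [← hk, nrm] at hy
    exact (Real.le_sqrt' (by positivity)).1 hy
  have hD : 1 ≤ y.1 ^ 4 + y.2 ^ 2 := by
    nlinarith [sq_nonneg (y.1 ^ 2 - 1)]
  have hy₀ : y ≠ 0 := by
    rintro rfl
    norm_num at hD
  have hquad : 2 * k * y.1 ^ 2 ≤ y.1 ^ 4 + y.2 ^ 2 := by
    rcases le_total (2 * k) (y.1 ^ 2) with h | h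
    · nlinarith [sq_nonneg y.1, sq_nonneg y.2]
    · nlinarith [sq_nonneg (y.1 ^ 2 - k)]
  have hdom : 10 * y.1 ^ 2 ≤ α * (y.1 ^ 4 + y.2 ^ 2) := by
    calc 10 * y.1 ^ 2 = α * (2 * k * y.1 ^ 2) := by linear_combination -2 * y.1 ^ 2 * hαk
      _ ≤ _ := mul_le_mul_of_nonneg_left hquad hα.le
  have hg_nonneg : 0 ≤ δ * g y := by
    rw [hg]
    have := Real.log_nonneg hD
    positivity
  have hGOU : C_F ≤ GOU α g y := by
    rw [GOU_log_quartic hg hy₀]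
    calc C_F = C_F / α * α := by field_simp
      _ ≤ _ := mul_le_mul_of_nonneg_left
        (le_drift_add_diffusion hα (by linarith) hdom) (by positivity)
  linarith
end
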